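/- arXiv:2602.01807 — 2 statements merged into one kernel-verified Lean document; each statement's English description precedes it below -/
import Mathlib

section
/- Let d and V be positive integers, e : Fin V → ℝ^d embeddings with ‖e k‖ = 1 for all k, and fix a target index y. Define f(h) = −⟨e y, h⟩ + log (Σ_{k} exp(⟨e k, h⟩)), the softmax weights p_k = exp(⟨e k, e y⟩) / Σ_{j} exp(⟨e j, e y⟩), and the tangent components u_k = e k − ⟨e y, e k⟩ · e y. If the local isotropy condition Σ_{k} p_k · u_k = 0 holds, then h = e y satisfies the Lagrange stationarity condition for minimizing f over the unit sphere: there exists λ ∈ ℝ such that ∇f(e y) = 2λ · e y. (Lemma: The Optimal Solution of Maximum Likelihood Estimation.) -/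
open Real
open scoped RealInnerProductSpace BigOperators

/-- The gradient of `h ↦ -⟪t, h⟫ + log (∑ k, exp ⟪e k, h⟫)` is `-t` plus the softmax-weighted
average of the vectors `e k`. -/
lemma hasGradientAt_neg_inner_add_log_sum_exp {ι E : Type*} [Fintype ι] [Nonempty ι]
    [NormedAddCommGroup E] [InnerProductSpace ℝ E] [CompleteSpace E]
    (e : ι → E) (t h : E) :
    HasGradientAt (fun x => -⟪t, x⟫ + Real.log (∑ k, Real.exp ⟪e k, x⟫))
      (-t + ∑ k, (Real.exp ⟪e k, h⟫ / ∑ j, Real.exp ⟪e j, h⟫) • e k) h := by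
  have hinner (v : E) : HasFDerivAt (fun x => ⟪v, x⟫) (innerSL ℝ v) h :=
    (innerSL ℝ v).hasFDerivAt
  have hpos : 0 < ∑ k, Real.exp ⟪e k, h⟫ :=
    Finset.sum_pos (fun _ _ => Real.exp_pos _) Finset.univ_nonempty
  have hsum : HasFDerivAt (fun x => ∑ k, Real.exp ⟪e k, x⟫)
      (∑ k, Real.exp ⟪e k, h⟫ • innerSL ℝ (e k)) h :=
    HasFDerivAt.fun_sum fun k _ => (hinner (e k)).exp
  rw [hasGradientAt_iff_hasFDerivAt]
  refine ((hinner t).neg.add (hsum.log hpos.ne')).congr_fderiv ?_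
  ext x
  simp [Finset.mul_sum, div_eq_inv_mul, mul_assoc]

/-- **Lemma (The Optimal Solution of Maximum Likelihood Estimation).**
Under the unit-norm constraint and the local isotropy assumption on the target
embedding's tangent space, `h = e y` satisfies the Lagrange stationarity condition
for minimizing the negative log-likelihood over the unit sphere. -/
theorem optimal_solution_mle
    (d V : ℕ) (hd : 0 < d) (hV : 0 < V)
    (e : Fin V → EuclideanSpace ℝ (Fin d))
    (he : ∀ k, ‖e k‖ = 1)
    (y : Fin V)
    (f : EuclideanSpace ℝ (Fin d) → ℝ)
    (hf : ∀ h, f h = -⟪e y, h⟫ + Real.log (∑ k, Real.exp ⟪e k, h⟫))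
    (p : Fin V → ℝ)
    (hp : ∀ k, p k = Real.exp ⟪e k, e y⟫ / ∑ j, Real.exp ⟪e j, e y⟫)
    (u : Fin V → EuclideanSpace ℝ (Fin d))
    (hu : ∀ k, u k = e k - ⟪e y, e k⟫ • e y)
    (hiso : ∑ k, p k • u k = 0) :
    ∃ lam : ℝ, gradient f (e y) = (2 * lam) • e y := by
  have : Nonempty (Fin V) := ⟨y⟩
  have hgrad : gradient f (e y) = -e y + ∑ k, p k • e k := by
    rw [funext hf, (hasGradientAt_neg_inner_add_log_sum_exp e (e y) (e y)).gradient]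
    simp_rw [hp]
  have havg : ∑ k, p k • e k = (∑ k, p k * ⟪e y, e k⟫) • e y := by
    simpa only [hu, smul_sub, smul_smul, Finset.sum_sub_distrib, ← Finset.sum_smul,
      sub_eq_zero] using hiso
  refine ⟨(∑ k, p k * ⟪e y, e k⟫ - 1) / 2, ?_⟩
  rw [hgrad, havg]
  module
end

section
/- Let d, L, N be positive integers and B⁺ : Matrix (Fin L) (Fin N) ℝ a matrix of rank L (full row rank), so that G := B⁺ · (B⁺)ᵀ is symmetric positive definite with eigenvalues λ_max ≥ λ_min > 0. Let V_global := (1/√(dL)) · 𝟙_{d×L} and, for i ∈ Fin L, V_local,i := 𝟙_d · δ_iᵀ. Then the relative importance of global versus local errors satisfies R(B⁺) := I(V_global) / I(V_local,i) ≤ λ_max / λ_min, where I(V) := ‖V · B⁺‖_F². (Lemma 3, second claim.) -/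
open Matrix
open scoped BigOperators

namespace Matrix

open scoped MatrixOrder

/-- The Rayleigh form of a Hermitian matrix is bounded above by any bound on its eigenvalues. -/
lemma IsHermitian.dotProduct_mulVec_le {n : Type*} [Fintype n] [DecidableEq n]
    {A : Matrix n n ℝ} (hA : A.IsHermitian) {c : ℝ} (hc : ∀ k, hA.eigenvalues k ≤ c)
    (x : n → ℝ) : x ⬝ᵥ (A *ᵥ x) ≤ c * (x ⬝ᵥ x) := by
  have hle : A ≤ algebraMap ℝ (Matrix n n ℝ) c := by
    refine le_algebraMap_of_spectrum_le (fun y hy => ?_) hA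
    obtain ⟨k, rfl⟩ := hA.spectrum_real_eq_range_eigenvalues ▸ hy
    exact hc k
  have hform := (Matrix.le_iff.mp hle).dotProduct_mulVec_nonneg x
  simpa [sub_mulVec, dotProduct_sub, Algebra.algebraMap_eq_smul_one, smul_mulVec] using hform

/-- The Rayleigh form of a Hermitian matrix is bounded below by any lower bound on its
eigenvalues. -/
lemma IsHermitian.le_dotProduct_mulVec {n : Type*} [Fintype n] [DecidableEq n]
    {A : Matrix n n ℝ} (hA : A.IsHermitian) {c : ℝ} (hc : ∀ k, c ≤ hA.eigenvalues k)
    (x : n → ℝ) : c * (x ⬝ᵥ x) ≤ x ⬝ᵥ (A *ᵥ x) := by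
  have hle : algebraMap ℝ (Matrix n n ℝ) c ≤ A := by
    refine algebraMap_le_of_le_spectrum (fun y hy => ?_) hA
    obtain ⟨k, rfl⟩ := hA.spectrum_real_eq_range_eigenvalues ▸ hy
    exact hc k
  have hform := (Matrix.le_iff.mp hle).dotProduct_mulVec_nonneg x
  simpa [sub_mulVec, dotProduct_sub, Algebra.algebraMap_eq_smul_one, smul_mulVec] using hform

/-- The squared Frobenius norm of `V * B` is the sum over the rows of `V` of the quadratic form
of the Gram matrix `B * Bᵀ`. -/
lemma sum_sq_mul_eq_sum_dotProduct_mulVec {l m n : Type*} [Fintype l] [Fintype m] [Fintype n]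
    (V : Matrix l m ℝ) (B : Matrix m n ℝ) :
    ∑ r, ∑ j, ((V * B) r j) ^ 2 = ∑ r, V r ⬝ᵥ ((B * Bᵀ) *ᵥ V r) := by
  refine Finset.sum_congr rfl fun r _ => ?_
  rw [← mulVec_mulVec, dotProduct_mulVec, mulVec_transpose]
  exact Finset.sum_congr rfl fun j _ => pow_two _

/-- The Gram matrix of a real matrix with full row rank is positive definite. -/
lemma posDef_mul_transpose_of_rank_eq_card {m n : Type*} [Fintype m] [Fintype n]
    {B : Matrix m n ℝ} (hB : B.rank = Fintype.card m) : (B * Bᵀ).PosDef := by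
  rw [← conjTranspose_eq_transpose_of_trivial]
  refine PosDef.mul_conjTranspose_self B (vecMul_injective_iff.mpr ?_)
  rw [linearIndependent_iff_card_eq_finrank_span, ← hB, rank_eq_finrank_span_row, Set.finrank]

end Matrix

/-- **Lemma 3 (second claim).** When `B⁺` has full row rank `L`, the Gram matrix
`G = B⁺(B⁺)ᵀ` is symmetric positive definite and the relative importance of the global
error versus any local error is bounded by the eigenvalue ratio `λ_max / λ_min`. -/
theorem relative_importance_bound
    (d L N : ℕ) (hd : 0 < d) (hL : 0 < L) (hN : 0 < N)
    (Bplus : Matrix (Fin L) (Fin N) ℝ)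
    (hrank : Bplus.rank = L)
    (G : Matrix (Fin L) (Fin L) ℝ) (hGdef : G = Bplus * Bplusᵀ)
    (hG : G.IsHermitian)
    (Vglobal : Matrix (Fin d) (Fin L) ℝ)
    (hVg : Vglobal = Matrix.of fun _ _ => 1 / Real.sqrt ((d : ℝ) * (L : ℝ)))
    (Vlocal : Fin L → Matrix (Fin d) (Fin L) ℝ)
    (hVl : ∀ i, Vlocal i = Matrix.of fun _ c => if c = i then (1 : ℝ) else 0) :
    G.PosDef ∧
      ∀ i : Fin L,
        (∑ r, ∑ j, ((Vglobal * Bplus) r j) ^ 2) /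
            (∑ r, ∑ j, ((Vlocal i * Bplus) r j) ^ 2) ≤
          Finset.univ.sup'
              (Finset.univ_nonempty_iff.mpr (Fin.pos_iff_nonempty.mp hL))
              hG.eigenvalues /
            Finset.univ.inf'
              (Finset.univ_nonempty_iff.mpr (Fin.pos_iff_nonempty.mp hL))
              hG.eigenvalues := by
  subst hGdef
  have hpos : (Bplus * Bplusᵀ).PosDef :=
    Matrix.posDef_mul_transpose_of_rank_eq_card (by simpa using hrank)
  refine ⟨hpos, fun i => ?_⟩
  have hd1 : (1 : ℝ) ≤ d := by exact_mod_cast hd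
  have hd0 : (0 : ℝ) < d := by exact_mod_cast hd
  have hL0 : (0 : ℝ) < L := by exact_mod_cast hL
  have hne : (Finset.univ : Finset (Fin L)).Nonempty :=
    Finset.univ_nonempty_iff.mpr (Fin.pos_iff_nonempty.mp hL)
  have hmin : 0 < Finset.univ.inf' hne hG.eigenvalues :=
    (Finset.lt_inf'_iff hne).mpr fun k _ => hpos.eigenvalues_pos k
  have hmax : 0 ≤ Finset.univ.sup' hne hG.eigenvalues :=
    (hpos.eigenvalues_pos i).le.trans (Finset.le_sup' hG.eigenvalues (Finset.mem_univ i))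
  rw [Matrix.sum_sq_mul_eq_sum_dotProduct_mulVec, Matrix.sum_sq_mul_eq_sum_dotProduct_mulVec]
  refine div_le_div₀ hmax ?_ hmin ?_
  · have hnorm (r : Fin d) : Vglobal r ⬝ᵥ Vglobal r = 1 / d := by
      have hsq := Real.mul_self_sqrt (mul_pos hd0 hL0).le
      simp only [hVg, dotProduct, Matrix.of_apply, Finset.sum_const, Finset.card_univ,
        Fintype.card_fin, nsmul_eq_mul]
      rw [div_mul_div_comm, hsq]
      field_simp
    calc ∑ r, Vglobal r ⬝ᵥ ((Bplus * Bplusᵀ) *ᵥ Vglobal r)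
        ≤ ∑ r : Fin d, Finset.univ.sup' hne hG.eigenvalues * (Vglobal r ⬝ᵥ Vglobal r) :=
          Finset.sum_le_sum fun r _ => hG.dotProduct_mulVec_le
            (fun k => Finset.le_sup' hG.eigenvalues (Finset.mem_univ k)) _
      _ = Finset.univ.sup' hne hG.eigenvalues := by
          simp only [hnorm, Finset.sum_const, Finset.card_univ, Fintype.card_fin, nsmul_eq_mul]
          field_simp
  · have hnorm (r : Fin d) : Vlocal i r ⬝ᵥ Vlocal i r = 1 := by
      simp [hVl, dotProduct]
    calc Finset.univ.inf' hne hG.eigenvalues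
        ≤ d * Finset.univ.inf' hne hG.eigenvalues := le_mul_of_one_le_left hmin.le hd1
      _ = ∑ r : Fin d, Finset.univ.inf' hne hG.eigenvalues * (Vlocal i r ⬝ᵥ Vlocal i r) := by
          simp [hnorm]
      _ ≤ ∑ r, Vlocal i r ⬝ᵥ ((Bplus * Bplusᵀ) *ᵥ Vlocal i r) :=
          Finset.sum_le_sum fun r _ => hG.le_dotProduct_mulVec
            (fun k => Finset.inf'_le hG.eigenvalues (Finset.mem_univ k)) _
end
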